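/- arXiv:1710.02548 — 4 statements merged into one kernel-verified Lean document; each statement's English description precedes it below -/
import Mathlib

section
/- The weight function w of the store-and-forward allocation (SFA) stationary measure is summable over all multi-configurations, with total sum equal to the normalizing constant: the family m ↦ w(m), for m : K → ℕ, has sum Σ_{m : K → ℕ} w(m) = ∏_{l ∈ L} C_l / (C_l − Σ_{j ∈ J} B_{lj} α_j). In particular the SFA measure π̃(m) = w(m)/Φ is a probability mass function on the countable set of functions K → ℕ. -/
open scoped BigOperators

noncomputable section

/-- The set of resource-route pairs `(l,j)` actually used, i.e. with `B l j > 0`. -/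
abbrev sfaK {L J : Type*} (B : L → J → ℝ) := {p : L × J // 0 < B p.1 p.2}

/-- The weight function of the SFA stationary measure:
`w(m) = ∏_l [ m_l! / ∏_j m_{lj}! ] · ∏_{(l,j) ∈ K} (B_{lj} α_j / C_l)^{m_{lj}}`. -/
noncomputable def sfaW {L J : Type*} [Fintype L] [Fintype J]
    (B : L → J → ℝ) (C : L → ℝ) (α : J → ℝ) (m : sfaK B → ℕ) : ℝ :=
  (∏ l : L,
      ((Nat.factorial (∑ j : {j : J // 0 < B l j}, m ⟨(l, j.1), j.2⟩) : ℝ) /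
        ∏ j : {j : J // 0 < B l j}, (Nat.factorial (m ⟨(l, j.1), j.2⟩) : ℝ))) *
    ∏ p : sfaK B, (B p.1.1 p.1.2 * α p.1.2 / C p.1.1) ^ m p

/-- The normalizing constant `Φ = ∏_l C_l / (C_l - Σ_j B_{lj} α_j)`. -/
noncomputable def sfaPhi {L J : Type*} [Fintype L] [Fintype J]
    (B : L → J → ℝ) (C : L → ℝ) (α : J → ℝ) : ℝ :=
  ∏ l : L, C l / (C l - ∑ j : J, B l j * α j)

def SfaPiProp.{u, v} (ι : Type u) [Fintype ι] : Prop :=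
  ∀ (β : ι → Type v) (f : ∀ i, β i → ℝ)
    (a : ι → ℝ), (∀ i x, 0 ≤ f i x) → (∀ i, HasSum (f i) (a i)) →
    HasSum (fun m : (∀ i, β i) => ∏ i, f i (m i)) (∏ i, a i)

theorem sfa_pi_equiv.{u, v} (ι κ : Type u) [Fintype ι] [Fintype κ] (e : ι ≃ κ)
    (ih : SfaPiProp.{u, v} ι) : SfaPiProp.{u, v} κ := by
  intro β f a hf hs
  have h := ih (fun i => β (e i)) (fun i => f (e i)) (fun i => a (e i))
    (fun i => hf (e i)) (fun i => hs (e i))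
  have h2 := (Equiv.hasSum_iff (Equiv.piCongrLeft β e).symm).2 h
  rw [Equiv.prod_comp e a] at h2
  have h3 : (fun m : (∀ i, β i) => ∏ i, f i (m i)) =
      (fun m : (∀ i, β (e i)) => ∏ i, f (e i) (m i)) ∘ (Equiv.piCongrLeft β e).symm := by
    funext m
    rw [Function.comp_apply, ← Equiv.prod_comp e (fun k => f k (m k))]
    refine Finset.prod_congr rfl fun i _ => ?_
    rw [Equiv.piCongrLeft_symm_apply]
  rw [h3]
  exact h2

theorem sfa_pi_empty.{u, v} : SfaPiProp.{u, v} PEmpty := by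
  intro β f a hf hs
  simp

theorem sfa_pi_option.{u, v} (ι : Type u) [Fintype ι]
    (ih : SfaPiProp.{u, v} ι) : SfaPiProp.{u, v} (Option ι) := by
  intro β f a hf hs
  have h := ih (fun i => β (some i)) (fun i => f (some i)) (fun i => a (some i))
    (fun i => hf (some i)) (fun i => hs (some i))
  have hm := (hs none).mul h ((hs none).summable.mul_of_nonneg h.summable (fun x => hf _ x)
    (fun x => Finset.prod_nonneg fun i _ => hf _ _))
  have h2 := (Equiv.hasSum_iff (Equiv.piOptionEquivProd (β := β))).2 hm
  rw [Fintype.prod_option]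
  have h3 : (fun m : (∀ i, β i) => ∏ i, f i (m i)) =
      (fun x : β none × (∀ i, β (some i)) => f none x.1 * ∏ i, f (some i) (x.2 i)) ∘
        Equiv.piOptionEquivProd := by
    funext m
    rw [Fintype.prod_option]
    rfl
  rw [h3]
  exact h2

theorem sfa_aux_hasSum_pi.{u, v} (ι : Type u) [Fintype ι] : SfaPiProp.{u, v} ι :=
  Fintype.induction_empty_option (P := fun ι _ => SfaPiProp.{u, v} ι)
    (fun ι κ _ e h => @sfa_pi_equiv ι κ (Fintype.ofEquiv κ e.symm) _ e h)
    sfa_pi_empty (fun ι _ h => sfa_pi_option ι h) ι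

theorem sfa_aux_hasSum_multinomial {ι : Type*} [Fintype ι] (x : ι → ℝ) (hx : ∀ i, 0 ≤ x i)
    (h1 : ∑ i, x i < 1) :
    HasSum (fun m : ι → ℕ => ((Nat.factorial (∑ i, m i) : ℝ) / ∏ i, (Nat.factorial (m i) : ℝ)) *
      ∏ i, x i ^ m i) (1 - ∑ i, x i)⁻¹ := by
  classical
  set F : (ι → ℕ) → ℝ := fun m => ((Nat.factorial (∑ i, m i) : ℝ) /
      ∏ i, (Nat.factorial (m i) : ℝ)) * ∏ i, x i ^ m i with hF
  have hF0 : ∀ m, 0 ≤ F m := fun m =>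
    mul_nonneg (by positivity) (Finset.prod_nonneg fun i _ => pow_nonneg (hx i) _)
  have hgeo := hasSum_geometric_of_lt_one (Finset.sum_nonneg fun i _ => hx i) h1
  let e := Equiv.sigmaFiberEquiv (fun m : ι → ℕ => ∑ i, m i)
  rw [← Equiv.hasSum_iff e]
  have hfib : ∀ n : ℕ, HasSum (fun c : {m : ι → ℕ // ∑ i, m i = n} => (F ∘ e) ⟨n, c⟩)
      ((∑ i, x i) ^ n) := by
    intro n
    have hset : {m : ι → ℕ | ∑ i, m i = n} =
        ((Finset.piAntidiag Finset.univ n : Finset (ι → ℕ)) : Set (ι → ℕ)) := by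
      ext m; simp
    have hs : HasSum (F ∘ ((↑) : {m : ι → ℕ | ∑ i, m i = n} → (ι → ℕ))) ((∑ i, x i) ^ n) := by
      rw [hset, Finset.sum_pow_eq_sum_piAntidiag]
      have : ∑ k ∈ Finset.piAntidiag Finset.univ n,
          (Nat.multinomial Finset.univ k : ℝ) * ∏ i, x i ^ k i =
          ∑ k ∈ Finset.piAntidiag Finset.univ n, F k := by
        refine Finset.sum_congr rfl fun k _ => ?_
        simp only [hF]
        congr 1
        rw [eq_div_iff (by positivity), mul_comm]
        exact_mod_cast Nat.multinomial_spec Finset.univ k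
      rw [this]
      exact Finset.hasSum _ F
    exact hs
  have hsum : Summable (F ∘ e) := by
    refine (summable_sigma_of_nonneg (f := F ∘ e) (fun y => hF0 _)).2 ⟨fun n => (hfib n).summable, ?_⟩
    simp_rw [fun n => (hfib n).tsum_eq]
    exact hgeo.summable
  exact HasSum.sigma_of_hasSum hgeo hfib hsum

theorem sfa_aux_hasSum {L J : Type*} [Fintype L] [Fintype J]
    (B : L → J → ℝ) (C : L → ℝ) (α : J → ℝ)
    (hB : ∀ l j, 0 ≤ B l j) (hC : ∀ l, 0 < C l) (hα : ∀ j, 0 ≤ α j)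
    (hg : ∀ l, (∑ j : J, B l j * α j) / C l < 1) :
    HasSum (fun m : sfaK B → ℕ => sfaW B C α m) (sfaPhi B C α) := by
  have hx : ∀ l (j : {j : J // 0 < B l j}), 0 ≤ B l j * α j / C l := fun l j =>
    div_nonneg (mul_nonneg (hB _ _) (hα _)) (hC l).le
  have hsum : ∀ l, ∑ j : {j : J // 0 < B l j}, B l j * α j / C l =
      (∑ j : J, B l j * α j) / C l := by
    intro l
    rw [Finset.sum_div, ← Finset.sum_subtype (Finset.univ.filter fun j => 0 < B l j) (by simp)
      (fun j => B l j * α j / C l)]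
    refine Finset.sum_subset (Finset.subset_univ _) fun j _ hj => ?_
    have h0 : B l j = 0 := le_antisymm (by simpa using hj) (hB l j)
    simp [h0]
  have h := sfa_aux_hasSum_pi L (fun l => {j : J // 0 < B l j} → ℕ) _ _
    (fun l m => mul_nonneg (by positivity)
      (Finset.prod_nonneg fun i _ => pow_nonneg (hx l i) _))
    (fun l => sfa_aux_hasSum_multinomial (fun j : {j : J // 0 < B l j} => B l j * α j / C l)
      (hx l) (by rw [hsum]; exact hg l))
  let e : (sfaK B → ℕ) ≃ (∀ l, {j : J // 0 < B l j} → ℕ) :=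
    { toFun := fun m l j => m ⟨(l, j.1), j.2⟩
      invFun := fun m p => m p.1.1 ⟨p.1.2, p.2⟩
      left_inv := fun _ => rfl
      right_inv := fun _ => rfl }
  let e' : (Σ l, {j : J // 0 < B l j}) ≃ sfaK B :=
    { toFun := fun p => ⟨(p.1, p.2.1), p.2.2⟩
      invFun := fun p => ⟨p.1.1, ⟨p.1.2, p.2⟩⟩
      left_inv := fun _ => rfl
      right_inv := fun _ => rfl }
  rw [← Equiv.hasSum_iff e] at h
  convert h using 1
  · funext m
    simp only [sfaW, Function.comp, Finset.prod_mul_distrib]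
    congr 1
    rw [← Equiv.prod_comp e', Fintype.prod_sigma]
    rfl
  · refine Finset.prod_congr rfl fun l _ => ?_
    rw [hsum]
    have := (hC l).ne'
    rw [one_sub_div this, inv_div]

/-- the SFA weight function is summable over all multi-configurations
`m : K → ℕ`, with total sum equal to the normalizing constant `Φ`; in particular
`π̃(m) = w(m)/Φ` is a probability mass function on `K → ℕ`. -/
theorem sfa_w_summable_and_normalized
    {L J : Type*} [Fintype L] [Fintype J] [Nonempty L] [Nonempty J]
    (B : L → J → ℝ) (C : L → ℝ) (α : J → ℝ)
    (hB : ∀ l j, 0 ≤ B l j) (hC : ∀ l, 0 < C l) (hα : ∀ j, 0 ≤ α j)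
    (hg : ∀ l, (∑ j : J, B l j * α j) / C l < 1) :
    Summable (fun m : sfaK B → ℕ => sfaW B C α m) ∧
      (∑' m : sfaK B → ℕ, sfaW B C α m) = sfaPhi B C α ∧
      (∀ m : sfaK B → ℕ, 0 ≤ sfaW B C α m / sfaPhi B C α) ∧
      (∑' m : sfaK B → ℕ, sfaW B C α m / sfaPhi B C α) = 1 := by
  have h := sfa_aux_hasSum B C α hB hC hα hg
  have hpos : 0 < sfaPhi B C α := Finset.prod_pos fun l _ =>
    div_pos (hC l) (sub_pos.2 ((div_lt_one (hC l)).1 (hg l)))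
  refine ⟨h.summable, h.tsum_eq, fun m => div_nonneg ?_ hpos.le, ?_⟩
  · exact mul_nonneg (by positivity) (Finset.prod_nonneg fun p _ =>
      pow_nonneg (div_nonneg (mul_nonneg (hB _ _) (hα _)) (hC _).le) _)
  · rw [tsum_div_const, h.tsum_eq, div_self hpos.ne']
end
end

section
/- Under the SFA stationary measure π̃, the configurations at distinct resources are independent, with explicit per-resource marginals: for every fixed resource l ∈ L and every fixed vector μ : {j : (l,j) ∈ K} → ℕ, the total π̃-mass of all m : K → ℕ whose restriction to resource l equals μ is Σ_{m : m(l,·) = μ} π̃(m) = (1 − g_l) · [ (Σ_j μ_j)! / ∏_j (μ_j!) ] · ∏_{j : (l,j) ∈ K} (B_{lj} α_j / C_l)^{μ_j}. -/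
open scoped BigOperators

noncomputable section

theorem sfa_aux_multinomial {ι : Type*} [Fintype ι] (x : ι → ℝ) (hx : ∀ i, 0 ≤ x i)
    (h1 : ∑ i, x i < 1) :
    HasSum (fun n : ι → ℕ => ((Nat.factorial (∑ i, n i) : ℝ) / ∏ i, (Nat.factorial (n i) : ℝ)) *
      ∏ i, x i ^ n i) (1 - ∑ i, x i)⁻¹ := by
  classical
  set f : (ι → ℕ) → ℝ := fun n =>
    ((Nat.factorial (∑ i, n i) : ℝ) / ∏ i, (Nat.factorial (n i) : ℝ)) * ∏ i, x i ^ n i with hf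
  have hf0 : ∀ n, 0 ≤ f n := fun n => mul_nonneg (by positivity)
    (Finset.prod_nonneg fun i _ => pow_nonneg (hx i) _)
  have hfm : ∀ n, f n = (Nat.multinomial Finset.univ n : ℝ) * ∏ i, x i ^ n i := by
    intro n
    have h := Nat.multinomial_spec Finset.univ n
    have h' : (∏ i, (Nat.factorial (n i) : ℝ)) * (Nat.multinomial Finset.univ n : ℝ)
        = (Nat.factorial (∑ i, n i) : ℝ) := by exact_mod_cast h
    have hne : (∏ i, (Nat.factorial (n i) : ℝ)) ≠ 0 := by positivity
    simp only [hf]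
    rw [← h', mul_div_cancel_left₀ _ hne]
  have hfib : ∀ k : ℕ, HasSum (fun y : {n : ι → ℕ // ∑ i, n i = k} => f y.1)
      ((∑ i, x i) ^ k) := by
    intro k
    have h := Finset.hasSum (Finset.piAntidiag Finset.univ k) f
    have e : ∀ n : ι → ℕ, (∑ i, n i = k) ↔ n ∈ Finset.piAntidiag Finset.univ k := by
      intro n; simp
    rw [Finset.sum_pow_eq_sum_piAntidiag]
    simp_rw [← hfm]
    exact (Equiv.subtypeEquivRight e).hasSum_iff.2 h
  have hgeo := hasSum_geometric_of_lt_one (Finset.sum_nonneg fun i _ => hx i) h1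
  rw [← (Equiv.sigmaFiberEquiv (fun n : ι → ℕ => ∑ i, n i)).hasSum_iff]
  refine HasSum.sigma_of_hasSum hgeo (fun k => hfib k) ?_
  refine (summable_sigma_of_nonneg (fun p => hf0 _)).2 ?_
  refine ⟨fun k => (hfib k).summable, ?_⟩
  have : (fun k : ℕ => ∑' y : {n : ι → ℕ // ∑ i, n i = k}, f y.1) = fun k => (∑ i, x i) ^ k :=
    funext fun k => (hfib k).tsum_eq
  exact this ▸ hgeo.summable

theorem sfa_aux_fin (n : ℕ) {β : Fin n → Type*} (f : ∀ i, β i → ℝ) (a : Fin n → ℝ)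
    (h0 : ∀ i b, 0 ≤ f i b) (h : ∀ i, HasSum (f i) (a i)) :
    HasSum (fun b : ∀ i, β i => ∏ i, f i (b i)) (∏ i, a i) := by
  induction n with
  | zero => simp
  | succ n ih =>
    have ih' := ih (fun i => f i.succ) (fun i => a i.succ) (fun i b => h0 _ b) (fun i => h _)
    rw [Fin.prod_univ_succ, ← (Fin.consEquiv β).hasSum_iff]
    have hs : Summable (fun p : β 0 × (∀ i : Fin n, β i.succ) =>
        f 0 p.1 * ∏ i : Fin n, f i.succ (p.2 i)) :=
      Summable.mul_of_nonneg (f := f 0)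
        (g := fun b : ∀ i : Fin n, β i.succ => ∏ i : Fin n, f i.succ (b i))
        (h 0).summable ih'.summable (fun b => h0 _ b)
        (fun b => Finset.prod_nonneg fun i _ => h0 _ _)
    have hp := HasSum.mul (h 0) ih' hs
    have he : (fun b : ∀ i, β i => ∏ i, f i (b i)) ∘ (Fin.consEquiv β) =
        fun p : β 0 × (∀ i : Fin n, β i.succ) => f 0 p.1 * ∏ i : Fin n, f i.succ (p.2 i) := by
      funext p
      simp [Fin.prod_univ_succ, Fin.consEquiv]
    rw [he]
    exact hp

theorem sfa_aux_pi {ι : Type*} [Fintype ι] {β : ι → Type*} (f : ∀ i, β i → ℝ) (a : ι → ℝ)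
    (h0 : ∀ i b, 0 ≤ f i b) (h : ∀ i, HasSum (f i) (a i)) :
    HasSum (fun b : ∀ i, β i => ∏ i, f i (b i)) (∏ i, a i) := by
  have e := (Fintype.equivFin ι).symm
  have := sfa_aux_fin _ (fun i => f (e i)) (fun i => a (e i)) (fun i => h0 _) (fun i => h _)
  rw [e.prod_comp a] at this
  rw [← (Equiv.piCongrLeft β e).hasSum_iff]
  convert this using 2 with b
  simp only [Function.comp]
  rw [← e.prod_comp]
  simp

/-- Splitting configurations by resource. -/
def sfaAuxEquiv {L J : Type*} (B : L → J → ℝ) :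
    (sfaK B → ℕ) ≃ (∀ l, {j : J // 0 < B l j} → ℕ) where
  toFun m l j := m ⟨(l, j.1), j.2⟩
  invFun n p := n p.1.1 ⟨p.1.2, p.2⟩
  left_inv _ := rfl
  right_inv _ := rfl

/-- Pairs as a sigma type. -/
def sfaAuxSigma {L J : Type*} (B : L → J → ℝ) :
    (Σ l, {j : J // 0 < B l j}) ≃ sfaK B where
  toFun p := ⟨(p.1, p.2.1), p.2.2⟩
  invFun p := ⟨p.1.1, ⟨p.1.2, p.2⟩⟩
  left_inv _ := rfl
  right_inv _ := rfl

/-- under the SFA stationary measure `π̃(m) = w(m)/Φ`, the total mass of the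
configurations whose restriction to a fixed resource `l` equals a fixed vector `μ` is
`(1 - g_l) · [ (Σ_j μ_j)! / ∏_j μ_j! ] · ∏_j (B_{lj} α_j / C_l)^{μ_j}`. -/
theorem sfa_marginal_at_resource
    {L J : Type*} [Fintype L] [Fintype J] [Nonempty L] [Nonempty J]
    (B : L → J → ℝ) (C : L → ℝ) (α : J → ℝ)
    (hB : ∀ l j, 0 ≤ B l j) (hC : ∀ l, 0 < C l) (hα : ∀ j, 0 ≤ α j)
    (hg : ∀ l, (∑ j : J, B l j * α j) / C l < 1)
    (l : L) (μ : {j : J // 0 < B l j} → ℕ) :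
    (∑' m : {m : sfaK B → ℕ // ∀ j : {j : J // 0 < B l j}, m ⟨(l, j.1), j.2⟩ = μ j},
        sfaW B C α m.1 / sfaPhi B C α) =
      (1 - (∑ j : J, B l j * α j) / C l) *
        ((Nat.factorial (∑ j : {j : J // 0 < B l j}, μ j) : ℝ) /
          ∏ j : {j : J // 0 < B l j}, (Nat.factorial (μ j) : ℝ)) *
        ∏ j : {j : J // 0 < B l j}, (B l j.1 * α j.1 / C l) ^ μ j := by
  classical
  have hC' : ∀ l, C l ≠ 0 := fun l => (hC l).ne'
  have hlt : ∀ l, 0 < 1 - (∑ j : J, B l j * α j) / C l := fun l => sub_pos.2 (hg l)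
  have hx0 : ∀ l (j : {j : J // 0 < B l j}), 0 ≤ B l j.1 * α j.1 / C l := fun l j =>
    div_nonneg (mul_nonneg (hB _ _) (hα _)) (hC l).le
  have hsum : ∀ l, ∑ j : {j : J // 0 < B l j}, B l j.1 * α j.1 / C l
      = (∑ j : J, B l j * α j) / C l := by
    intro l
    rw [Finset.sum_div]
    rw [← Finset.sum_subtype (Finset.univ.filter fun j => 0 < B l j) (by simp)
      (fun j => B l j * α j / C l)]
    refine Finset.sum_filter_of_ne fun j _ hj => lt_of_le_of_ne (hB l j) fun h => hj ?_
    simp [← h]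
  -- the weight of one resource
  let f : ∀ l', ({j : J // 0 < B l' j} → ℕ) → ℝ := fun l' n =>
    ((Nat.factorial (∑ j, n j) : ℝ) / ∏ j, (Nat.factorial (n j) : ℝ)) *
      ∏ j, (B l' j.1 * α j.1 / C l') ^ n j
  have hf0 : ∀ l' n, 0 ≤ f l' n := fun l' n => mul_nonneg (by positivity)
    (Finset.prod_nonneg fun i _ => pow_nonneg (hx0 l' i) _)
  have hfs : ∀ l', HasSum (f l') (1 - (∑ j : J, B l' j * α j) / C l')⁻¹ := by
    intro l'
    have := sfa_aux_multinomial (fun j : {j : J // 0 < B l' j} => B l' j.1 * α j.1 / C l')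
      (hx0 l') (by rw [hsum]; exact hg l')
    rwa [hsum] at this
  have hw : ∀ m : sfaK B → ℕ, sfaW B C α m / sfaPhi B C α =
      ∏ l', (f l' (sfaAuxEquiv B m l') * (1 - (∑ j : J, B l' j * α j) / C l')) := by
    intro m
    have hPhi : (sfaPhi B C α)⁻¹ = ∏ l', (1 - (∑ j : J, B l' j * α j) / C l') := by
      rw [sfaPhi, ← Finset.prod_inv_distrib]
      refine Finset.prod_congr rfl fun l' _ => ?_
      rw [inv_div, sub_div, div_self (hC' l')]
    rw [div_eq_mul_inv, hPhi, Finset.prod_mul_distrib, sfaW]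
    congr 1
    simp only [f]
    rw [Finset.prod_mul_distrib]
    congr 1
    rw [← (sfaAuxSigma B).prod_comp, Fintype.prod_sigma]
    rfl
  obtain ⟨μ', hμ'⟩ : ∃ μ' : ∀ l', {j : J // 0 < B l' j} → ℕ, μ' l = μ :=
    ⟨Function.update (fun _ _ => 0) l μ, by simp⟩
  subst hμ'
  let F : ∀ l', ({j : J // 0 < B l' j} → ℕ) → ℝ := fun l' n =>
    if l' = l → n = μ' l' then f l' n * (1 - (∑ j : J, B l' j * α j) / C l') else 0
  have hF0 : ∀ l' n, 0 ≤ F l' n := by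
    intro l' n
    simp only [F]
    split_ifs
    · exact mul_nonneg (hf0 _ _) (hlt _).le
    · exact le_rfl
  have hFs : ∀ l', HasSum (F l') (if l' = l then
      f l' (μ' l') * (1 - (∑ j : J, B l' j * α j) / C l') else 1) := by
    intro l'
    by_cases hl : l' = l
    · simp only [F, hl, if_true, true_imp_iff]
      have := hasSum_single (f := F l') (μ' l') (fun n hn => by simp [F, hl, hn])
      subst hl
      simpa [F] using this
    · have := (hfs l').mul_right (1 - (∑ j : J, B l' j * α j) / C l')
      rw [inv_mul_cancel₀ (hlt l').ne'] at this
      simpa [F, hl] using this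
  have key := sfa_aux_pi F _ hF0 hFs
  rw [← (sfaAuxEquiv B).hasSum_iff, Finset.prod_ite_eq' Finset.univ l] at key
  have hfun : (fun b : ∀ l', {j : J // 0 < B l' j} → ℕ => ∏ l', F l' (b l')) ∘ sfaAuxEquiv B =
      Set.indicator {m : sfaK B → ℕ | ∀ j : {j : J // 0 < B l j}, m ⟨(l, j.1), j.2⟩ = μ' l j}
        (fun m => sfaW B C α m / sfaPhi B C α) := by
    funext m
    simp only [Function.comp, Set.indicator_apply, Set.mem_ofPred_eq, hw]
    split_ifs with hm
    · refine Finset.prod_congr rfl fun l' _ => ?_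
      refine if_pos ?_
      rintro rfl
      exact funext hm
    · refine Finset.prod_eq_zero (Finset.mem_univ l) (if_neg ?_)
      intro h
      exact hm fun j => congrFun (h rfl) j
  rw [hfun, ← hasSum_subtype_iff_indicator] at key
  refine key.tsum_eq.trans ?_
  simp only [Finset.mem_univ, if_true, f]
  ring
end
end

section
/- The SFA route-level stationary measure π aggregates the multi-configuration measure π̃: for every n : J → ℕ, the sum of π̃(m) over the finite set U(n) = {m : K → ℕ : Σ_{l : (l,j) ∈ K} m(l,j) = n_j for all j ∈ J} satisfies Σ_{m ∈ U(n)} π̃(m) = Φ(n) · ∏_{j ∈ J} α_j^{n_j} / Φ, where Φ(n) = Σ_{m ∈ U(n)} ∏_{l ∈ L} [ m_l!/∏_{j : (l,j) ∈ K} (m_{lj}!) ] · ∏_{(l,j) ∈ K} (B_{lj}/C_l)^{m_{lj}}. -/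
open scoped BigOperators

noncomputable section

/-- The set `U(n)` of multi-configurations `m : K → ℕ` compatible with the route-level
counts `n : J → ℕ`, i.e. `Σ_{l : (l,j) ∈ K} m(l,j) = n_j` for all `j`. -/
abbrev sfaU {L J : Type*} [Fintype L] (B : L → J → ℝ) (n : J → ℕ) :=
  {m : sfaK B → ℕ // ∀ j : J, (∑ l : {l : L // 0 < B l j}, m ⟨(l.1, j), l.2⟩) = n j}

/-- `Φ(n) = Σ_{m ∈ U(n)} ∏_l [ m_l!/∏_j m_{lj}! ] · ∏_{(l,j) ∈ K} (B_{lj}/C_l)^{m_{lj}}`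
(the set `U(n)` is finite, so the `tsum` is just the finite sum). -/
noncomputable def sfaPhiFun {L J : Type*} [Fintype L] [Fintype J]
    (B : L → J → ℝ) (C : L → ℝ) (n : J → ℕ) : ℝ :=
  ∑' m : sfaU B n,
    (∏ l : L,
        ((Nat.factorial (∑ j : {j : J // 0 < B l j}, m.1 ⟨(l, j.1), j.2⟩) : ℝ) /
          ∏ j : {j : J // 0 < B l j}, (Nat.factorial (m.1 ⟨(l, j.1), j.2⟩) : ℝ))) *
      ∏ p : sfaK B, (B p.1.1 p.1.2 / C p.1.1) ^ m.1 p

/-- the SFA route-level stationary measure aggregates the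
multi-configuration measure: `Σ_{m ∈ U(n)} π̃(m) = Φ(n) · ∏_j α_j^{n_j} / Φ`. -/
theorem sfa_route_level_aggregation
    {L J : Type*} [Fintype L] [Fintype J] [Nonempty L] [Nonempty J]
    (B : L → J → ℝ) (C : L → ℝ) (α : J → ℝ)
    (hB : ∀ l j, 0 ≤ B l j) (hC : ∀ l, 0 < C l) (hα : ∀ j, 0 ≤ α j)
    (hg : ∀ l, (∑ j : J, B l j * α j) / C l < 1)
    (n : J → ℕ) :
    (∑' m : sfaU B n, sfaW B C α m.1 / sfaPhi B C α) =
      sfaPhiFun B C n * (∏ j : J, α j ^ n j) / sfaPhi B C α := by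
  have key : ∀ m : sfaU B n, sfaW B C α m.1 / sfaPhi B C α =
      ((∏ l : L,
        ((Nat.factorial (∑ j : {j : J // 0 < B l j}, m.1 ⟨(l, j.1), j.2⟩) : ℝ) /
          ∏ j : {j : J // 0 < B l j}, (Nat.factorial (m.1 ⟨(l, j.1), j.2⟩) : ℝ))) *
      ∏ p : sfaK B, (B p.1.1 p.1.2 / C p.1.1) ^ m.1 p) *
        ((∏ j : J, α j ^ n j) / sfaPhi B C α) := by
    intro m
    have h1 : ∏ p : sfaK B, α p.1.2 ^ m.1 p = ∏ j : J, α j ^ n j := by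
      let e : (Σ j : J, {l : L // 0 < B l j}) ≃ sfaK B :=
        { toFun := fun x => ⟨(x.2.1, x.1), x.2.2⟩
          invFun := fun p => ⟨p.1.2, ⟨p.1.1, p.2⟩⟩
          left_inv := fun _ => rfl
          right_inv := fun _ => rfl }
      rw [← e.prod_comp, Fintype.prod_sigma]
      refine Finset.prod_congr rfl fun j _ => ?_
      rw [← m.2 j, ← Finset.prod_pow_eq_pow_sum]
      rfl
    have h2 : ∏ p : sfaK B, (B p.1.1 p.1.2 * α p.1.2 / C p.1.1) ^ m.1 p =
        (∏ p : sfaK B, (B p.1.1 p.1.2 / C p.1.1) ^ m.1 p) * ∏ j : J, α j ^ n j := by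
      rw [← h1, ← Finset.prod_mul_distrib]
      refine Finset.prod_congr rfl fun p _ => ?_
      rw [← mul_pow, div_mul_eq_mul_div]
    unfold sfaW
    rw [h2]
    ring
  rw [tsum_congr key, tsum_mul_right, mul_div_assoc]
  rfl
end
end

section
/- Expected number of flows of each type in the virtual bandwidth-sharing network with unit capacities (Proposition 4.5, stationary-expectation form): specialize the SFA stationary distribution to resources given by the node set V with C_v = 1, routes given by flow types t ∈ T, 0–1 incidence B_{vt} = 1 if node v lies on the route of type t and 0 otherwise, and traffic intensities α_t = x_t λ_t, where x_t > 0 is the flow size and λ_t ≥ 0 the arrival rate of type t; let f_v = Σ_{t : v ∈ r(t)} x_t λ_t and assume f_v < 1 for all v ∈ V. Then for every type t ∈ T, Σ_{n : T → ℕ} n_t · π(n) = Σ_{v ∈ r(t)} x_t λ_t / (1 − f_v). -/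
open scoped BigOperators

noncomputable section

open scoped ENNReal

theorem aux_tsum_pi {ι : Type*} [Fintype ι] {κ : ι → Type*} (f : ∀ i, κ i → ℝ≥0∞) :
    ∑' m : (∀ i, κ i), ∏ i, f i (m i) = ∏ i, ∑' k, f i k := by
  revert κ
  refine Fintype.induction_empty_option (P := fun ι _ => ∀ {κ : ι → Type _} (f : ∀ i, κ i → ℝ≥0∞),
    ∑' m : (∀ i, κ i), ∏ i, f i (m i) = ∏ i, ∑' k, f i k) ?_ ?_ ?_ ι
  · intro α β _ e h κ f
    let _ := Fintype.ofEquiv β e.symm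
    have h2 := h (fun a => f (e a))
    rw [← e.prod_comp (fun i => ∑' k, f i k)]
    convert! h2 using 1
    rw [← (Equiv.piCongrLeft κ e).tsum_eq]
    refine tsum_congr fun m => ?_
    rw [← e.prod_comp]
    simp [Equiv.piCongrLeft_apply_apply]
  · intro κ f
    simp
  · intro α _ h κ f
    rw [← (Equiv.piOptionEquivProd).symm.tsum_eq, ENNReal.tsum_prod']
    simp only [Fintype.prod_option, Equiv.piOptionEquivProd_symm_apply]
    simp_rw [ENNReal.tsum_mul_left]
    rw [ENNReal.tsum_mul_right, h (fun a => f (some a))]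

/-- multinomial weight -/
noncomputable def auxW {S : Type*} [Fintype S] (a : S → ℝ≥0∞) (m : S → ℕ) : ℝ≥0∞ :=
  (Nat.multinomial Finset.univ m : ℝ≥0∞) * ∏ s, a s ^ m s

theorem aux_group {S : Type*} [Fintype S] (a : S → ℝ≥0∞) (c : ℕ → ℝ≥0∞) :
    ∑' m : S → ℕ, c (∑ s, m s) * auxW a m = ∑' k, c k * (∑ s, a s) ^ k := by
  classical
  rw [← ENNReal.tsum_fiberwise _ (fun m : S → ℕ => ∑ s, m s)]
  refine tsum_congr fun k => ?_
  rw [Finset.sum_pow_eq_sum_piAntidiag, Finset.mul_sum, ← Finset.tsum_subtype]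
  have hS : ((fun m : S → ℕ => ∑ s, m s) ⁻¹' {k}) = {m | m ∈ Finset.piAntidiag Finset.univ k} := by
    ext m; simp
  rw [hS]
  refine tsum_congr fun m => ?_
  have : ∑ s, m.1 s = k := by have := m.2; simpa using this
  rw [this]; rfl

theorem aux_geom2 (r : ℝ≥0∞) : ∑' k : ℕ, ((k + 1 : ℕ) : ℝ≥0∞) * r ^ k = (1 - r)⁻¹ * (1 - r)⁻¹ := by
  rw [← ENNReal.tsum_geometric, ← ENNReal.tsum_mul_right]
  simp_rw [← ENNReal.tsum_mul_left]
  rw [← ENNReal.tsum_prod, ← Finset.HasAntidiagonal.sigmaAntidiagonalEquivProd.tsum_eq, ENNReal.tsum_sigma']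
  refine tsum_congr fun k => ?_
  rw [tsum_fintype]
  have : ∀ b : Finset.HasAntidiagonal.antidiagonal k, r ^ (Finset.HasAntidiagonal.sigmaAntidiagonalEquivProd ⟨k, b⟩).1 *
     r ^ (Finset.HasAntidiagonal.sigmaAntidiagonalEquivProd ⟨k, b⟩).2 = r ^ k := by
    intro b
    have := Finset.HasAntidiagonal.mem_antidiagonal.1 b.2
    simp [← pow_add, this]
  rw [Finset.sum_congr rfl (fun b _ => this b)]
  simp

theorem aux_W0 {S : Type*} [Fintype S] (a : S → ℝ≥0∞) :
    ∑' m : S → ℕ, auxW a m = (1 - ∑ s, a s)⁻¹ := by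
  have := aux_group a (fun _ => 1)
  simpa [ENNReal.tsum_geometric] using this

theorem aux_multi {S : Type*} [Fintype S] [DecidableEq S] (m : S → ℕ) (t : S) :
    (m t + 1) * Nat.multinomial Finset.univ (m + Pi.single t 1)
      = (∑ s, m s + 1) * Nat.multinomial Finset.univ m := by
  have h1 := Nat.multinomial_spec Finset.univ m
  have h2 := Nat.multinomial_spec Finset.univ (m + Pi.single t 1)
  have h3 : ∑ s, (m + Pi.single t 1 : S → ℕ) s = ∑ s, m s + 1 := by
    simp [Finset.sum_add_distrib]
  have h4 : ∏ s, ((m + Pi.single t 1 : S → ℕ) s).factorial = (m t + 1) * ∏ s, (m s).factorial := by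
    rw [← Finset.mul_prod_erase _ _ (Finset.mem_univ t),
      ← Finset.mul_prod_erase _ (fun s => (m s).factorial) (Finset.mem_univ t), ← mul_assoc]
    congr 1
    · simp [Nat.factorial_succ]
    · refine Finset.prod_congr rfl fun s hs => ?_
      simp [Finset.ne_of_mem_erase hs]
  rw [h3, h4, Nat.factorial_succ, ← h1] at h2
  have hp : 0 < ∏ s, (m s).factorial := Finset.prod_pos fun s _ => Nat.factorial_pos _
  apply Nat.eq_of_mul_eq_mul_left hp
  linarith

theorem aux_W1 {S : Type*} [Fintype S] (a : S → ℝ≥0∞) (t : S) :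
    ∑' m : S → ℕ, (m t : ℝ≥0∞) * auxW a m = a t * ((1 - ∑ s, a s)⁻¹ * (1 - ∑ s, a s)⁻¹) := by
  classical
  rw [← aux_geom2, ← aux_group a (fun k => ((k + 1 : ℕ) : ℝ≥0∞)), ← ENNReal.tsum_mul_left]
  have hinj : Function.Injective (fun m : S → ℕ => m + Pi.single t 1) := add_left_injective _
  rw [← hinj.tsum_eq]
  · refine tsum_congr fun m => ?_
    have h := congrArg (Nat.cast (R := ℝ≥0∞)) (aux_multi m t)
    have h4 : ∏ s, a s ^ ((m + Pi.single t 1 : S → ℕ) s) = a t * ∏ s, a s ^ m s := by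
      simp_rw [Pi.add_apply, pow_add, Finset.prod_mul_distrib]
      rw [mul_comm]
      congr 1
      rw [Finset.prod_eq_single t] <;> simp +contextual
    simp only [auxW]
    rw [h4]
    push_cast at h ⊢
    simp only [Pi.add_apply, Pi.single_eq_same]
    push_cast
    calc _ = a t * (((m t + 1 : ℝ≥0∞) * (Nat.multinomial Finset.univ (m + Pi.single t 1) : ℝ≥0∞)) * ∏ s, a s ^ m s) := by ring
      _ = _ := by rw [h]; ring
  · intro m hm
    have : m t ≠ 0 := by
      intro h0; simp [h0] at hm
    refine ⟨m - Pi.single t 1, ?_⟩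
    ext s
    by_cases h : s = t
    · subst h; simp; omega
    · simp [h]

theorem aux_total {L : Type*} [Fintype L] {S : L → Type*} [∀ l, Fintype (S l)]
    (a : ∀ l, S l → ℝ≥0∞) (l : L) (s : S l) :
    ∑' m : (∀ l, S l → ℕ), (m l s : ℝ≥0∞) * ∏ l, auxW (a l) (m l)
      = a l s * (1 - ∑ s, a l s)⁻¹ * ∏ l, (1 - ∑ s, a l s)⁻¹ := by
  classical
  have h := aux_tsum_pi (Function.update (fun l => auxW (a l)) l
    (fun m => (m s : ℝ≥0∞) * auxW (a l) m))
  have key : ∀ (g : ∀ l, ((S l → ℕ) → ℝ≥0∞) → ℝ≥0∞),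
      ∏ i, g i (Function.update (fun l => auxW (a l)) l (fun m => (m s : ℝ≥0∞) * auxW (a l) m) i)
      = g l (fun m => (m s : ℝ≥0∞) * auxW (a l) m) *
        ∏ i ∈ Finset.univ.erase l, g i (auxW (a i)) := by
    intro g
    rw [← Finset.mul_prod_erase _ _ (Finset.mem_univ l)]
    congr 1
    · simp
    · refine Finset.prod_congr rfl fun i hi => ?_
      rw [Function.update_of_ne (Finset.ne_of_mem_erase hi)]
  rw [key (fun i F => ∑' k, F k)] at h
  simp_rw [fun m : (∀ l, S l → ℕ) => key (fun i F => F (m i))] at h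
  simp only [aux_W0, aux_W1] at h
  rw [← Finset.mul_prod_erase _ (fun l => (1 - ∑ s, a l s)⁻¹) (Finset.mem_univ l)]
  calc _ = _ := ?_
    _ = _ := h
    _ = _ := by ring
  refine tsum_congr fun m => ?_
  rw [← Finset.mul_prod_erase _ _ (Finset.mem_univ l), mul_assoc]

def auxE {L J : Type*} (B : L → J → ℝ) : (∀ l, {j : J // 0 < B l j} → ℕ) ≃ (sfaK B → ℕ) where
  toFun m p := m p.1.1 ⟨p.1.2, p.2⟩
  invFun m l j := m ⟨(l, j.1), j.2⟩
  left_inv _ := rfl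
  right_inv _ := rfl

def auxSwap {L J : Type*} (B : L → J → ℝ) :
    (Σ j : J, {l : L // 0 < B l j}) ≃ (Σ l : L, {j : J // 0 < B l j}) where
  toFun p := ⟨p.2.1, ⟨p.1, p.2.2⟩⟩
  invFun p := ⟨p.2.1, ⟨p.1, p.2.2⟩⟩
  left_inv _ := rfl
  right_inv _ := rfl

/-- ENNReal weight -/
def auxQ {L J : Type*} [Fintype L] [Fintype J] (B : L → J → ℝ) (α : J → ℝ)
    (m : sfaK B → ℕ) : ℝ≥0∞ :=
  ∏ l : L, auxW (fun j : {j : J // 0 < B l j} => ENNReal.ofReal (α j.1))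
    (fun j => m ⟨(l, j.1), j.2⟩)

theorem auxQ_ne_top {L J : Type*} [Fintype L] [Fintype J] (B : L → J → ℝ) (α : J → ℝ)
    (m : sfaK B → ℕ) : auxQ B α m ≠ ⊤ := by
  unfold auxQ auxW
  refine ENNReal.prod_ne_top fun l _ => ENNReal.mul_ne_top (by simp) ?_
  exact ENNReal.prod_ne_top fun j _ => ENNReal.pow_ne_top (by simp)

theorem auxQ_toReal {L J : Type*} [Fintype L] [Fintype J] (B : L → J → ℝ)
    (hB : ∀ l j, 0 < B l j → B l j = 1) (α : J → ℝ) (hα : ∀ j, 0 ≤ α j)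
    (n : J → ℕ) (m : sfaU B n) :
    ((∏ l : L,
        ((Nat.factorial (∑ j : {j : J // 0 < B l j}, m.1 ⟨(l, j.1), j.2⟩) : ℝ) /
          ∏ j : {j : J // 0 < B l j}, (Nat.factorial (m.1 ⟨(l, j.1), j.2⟩) : ℝ))) *
      ∏ p : sfaK B, (B p.1.1 p.1.2 / 1) ^ m.1 p) * ∏ j, α j ^ n j
    = (auxQ B α m.1).toReal := by
  have h1 : ∏ p : sfaK B, (B p.1.1 p.1.2 / 1) ^ m.1 p = 1 :=
    Finset.prod_eq_one fun p _ => by rw [hB _ _ p.2]; simp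
  have h2 : ∏ j, α j ^ n j
      = ∏ l : L, ∏ j : {j : J // 0 < B l j}, α j.1 ^ m.1 ⟨(l, j.1), j.2⟩ := by
    have : ∀ j, α j ^ n j = ∏ l : {l : L // 0 < B l j}, α j ^ m.1 ⟨(l.1, j), l.2⟩ := by
      intro j; rw [← m.2 j, Finset.prod_pow_eq_pow_sum]
    simp_rw [this]
    rw [← Fintype.prod_sigma (fun p : (Σ j : J, {l : L // 0 < B l j}) =>
        α p.1 ^ m.1 ⟨(p.2.1, p.1), p.2.2⟩),
      ← Fintype.prod_sigma (fun p : (Σ l : L, {j : J // 0 < B l j}) =>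
        α p.2.1 ^ m.1 ⟨(p.1, p.2.1), p.2.2⟩)]
    exact Fintype.prod_equiv (auxSwap B) _ _ fun _ => rfl
  rw [h1, mul_one, h2, ← Finset.prod_mul_distrib]
  unfold auxQ auxW
  rw [ENNReal.toReal_prod]
  refine Finset.prod_congr rfl fun l _ => ?_
  rw [ENNReal.toReal_mul, ENNReal.toReal_prod, ENNReal.toReal_natCast]
  congr 1
  · rw [div_eq_iff (by positivity), mul_comm]
    have := Nat.multinomial_spec Finset.univ
      (fun j : {j : J // 0 < B l j} => m.1 ⟨(l, j.1), j.2⟩)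
    exact_mod_cast this.symm
  · refine Finset.prod_congr rfl fun j _ => ?_
    rw [ENNReal.toReal_pow, ENNReal.toReal_ofReal (hα _)]

theorem auxQ_total {L J : Type*} [Fintype L] [Fintype J] (B : L → J → ℝ) (α : J → ℝ) (t : J) :
    ∑' m : sfaK B → ℕ, ((∑ l : {l : L // 0 < B l t}, m ⟨(l.1, t), l.2⟩ : ℕ) : ℝ≥0∞) * auxQ B α m
    = ∑ l : {l : L // 0 < B l t}, ENNReal.ofReal (α t) *
        (1 - ∑ j : {j : J // 0 < B l.1 j}, ENNReal.ofReal (α j.1))⁻¹ *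
        ∏ l, (1 - ∑ j : {j : J // 0 < B l j}, ENNReal.ofReal (α j.1))⁻¹ := by
  rw [← (auxE B).tsum_eq]
  simp_rw [Nat.cast_sum, Finset.sum_mul]
  rw [Summable.tsum_finsetSum (fun _ _ => ENNReal.summable)]
  refine Finset.sum_congr rfl fun l _ => ?_
  exact aux_total (fun l (j : {j : J // 0 < B l j}) => ENNReal.ofReal (α j.1)) l.1 ⟨t, l.2⟩

theorem aux_main {L J : Type*} [Fintype L] [Fintype J] (B : L → J → ℝ)
    (hB : ∀ l j, 0 < B l j → B l j = 1) (hB' : ∀ l j, ¬ 0 < B l j → B l j = 0)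
    (α : J → ℝ) (hα : ∀ j, 0 ≤ α j)
    (hf : ∀ l, ∑ j, B l j * α j < 1) (t : J) :
    ∑' n : J → ℕ, (n t : ℝ) * (sfaPhiFun B (fun _ => 1) n * (∏ j, α j ^ n j) /
      sfaPhi B (fun _ => 1) α)
    = ∑ l : {l : L // 0 < B l t}, α t / (1 - ∑ j, B l j * α j) := by
  have hA : ∀ l, (1 - ∑ j : {j : J // 0 < B l j}, ENNReal.ofReal (α j.1))⁻¹
      = ENNReal.ofReal (1 / (1 - ∑ j, B l j * α j)) := by
    intro l
    have : ∑ j : {j : J // 0 < B l j}, α j.1 = ∑ j, B l j * α j := by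
      classical
      rw [← Finset.sum_subtype (Finset.univ.filter fun j => 0 < B l j) (by simp) α,
        Finset.sum_filter]
      refine Finset.sum_congr rfl fun j _ => ?_
      split_ifs with h
      · simp [hB l j h]
      · simp [hB' l j h]
    rw [← ENNReal.ofReal_sum_of_nonneg (fun j _ => hα _), this, ← ENNReal.ofReal_one,
      ← ENNReal.ofReal_sub, one_div, ENNReal.ofReal_inv_of_pos (by linarith [hf l])]
    rw [← this]; exact Finset.sum_nonneg fun j _ => hα _
  have hpos : ∀ l, 0 < 1 / (1 - ∑ j, B l j * α j) := fun l => by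
    have := hf l
    exact one_div_pos.2 (by linarith)
  have hPhi : sfaPhi B (fun _ => 1) α = ∏ l, 1 / (1 - ∑ j, B l j * α j) := rfl
  have hPhipos : 0 < sfaPhi B (fun _ => 1) α := by
    rw [hPhi]; exact Finset.prod_pos fun l _ => hpos l
  have htot := auxQ_total B α t
  simp_rw [hA] at htot
  rw [← ENNReal.ofReal_prod_of_nonneg (fun l _ => (hpos l).le), ← hPhi] at htot
  set F : (sfaK B → ℕ) → ℝ≥0∞ := fun m =>
    ((∑ l : {l : L // 0 < B l t}, m ⟨(l.1, t), l.2⟩ : ℕ) : ℝ≥0∞) * auxQ B α m with hF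
  have hfin : ∑' m, F m ≠ ⊤ := by
    rw [htot]
    exact ENNReal.sum_ne_top.2 fun l _ => by finiteness
  have hfib : ∑' n : J → ℕ, ∑' m : sfaU B n, F m.1 = ∑' m, F m := by
    rw [← ENNReal.tsum_fiberwise F
      (fun m (j : J) => ∑ l : {l : L // 0 < B l j}, m ⟨(l.1, j), l.2⟩)]
    refine tsum_congr fun n => ?_
    exact (Equiv.subtypeEquivRight (fun m => by
      simp only [Set.mem_preimage, Set.mem_singleton_iff]; exact funext_iff.symm)).tsum_eq
      (fun m : ((fun m (j : J) => ∑ l : {l : L // 0 < B l j}, m ⟨(l.1, j), l.2⟩) ⁻¹' {n} : Set (sfaK B → ℕ)) => F m.1)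
  have hterm : ∀ n : J → ℕ, (n t : ℝ) * (sfaPhiFun B (fun _ => 1) n * (∏ j, α j ^ n j) /
      sfaPhi B (fun _ => 1) α) = (∑' m : sfaU B n, F m.1).toReal / sfaPhi B (fun _ => 1) α := by
    intro n
    rw [← mul_div_assoc]
    congr 1
    unfold sfaPhiFun
    rw [← tsum_mul_right, ← tsum_mul_left, ENNReal.tsum_toReal_eq]
    · refine tsum_congr fun m => ?_
      rw [auxQ_toReal B hB α hα n m, hF]
      simp only [ENNReal.toReal_mul, ENNReal.toReal_natCast]
      rw [m.2 t]
    · intro m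
      exact ENNReal.mul_ne_top (by simp) (auxQ_ne_top _ _ _)
  simp_rw [hterm]
  rw [tsum_div_const, ← ENNReal.tsum_toReal_eq, hfib, htot, ENNReal.toReal_sum, Finset.sum_div]
  · refine Finset.sum_congr rfl fun l _ => ?_
    rw [ENNReal.toReal_mul, ENNReal.toReal_mul, ENNReal.toReal_ofReal (hα t),
      ENNReal.toReal_ofReal (hpos _).le, ENNReal.toReal_ofReal hPhipos.le,
      mul_div_cancel_right₀ _ hPhipos.ne', mul_one_div]
  · intro l _; finiteness
  · intro n
    refine ne_top_of_le_ne_top hfin ?_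
    rw [← hfib]
    exact ENNReal.le_tsum n

/-- Proposition 4.5, stationary-expectation form: in the virtual
bandwidth-sharing network with unit capacities (`L = V`, `J = T`, `B_{vt}` the 0-1
incidence of node `v` on the route of type `t`, `C_v = 1`, `α_t = x_t λ_t`), under the
stability condition `f_v = Σ_{t : v ∈ r(t)} x_t λ_t < 1` for all `v`, the expected
number of type-`t` flows under the SFA stationary distribution `π` equals
`Σ_{v ∈ r(t)} x_t λ_t / (1 - f_v)`. -/
theorem sfa_virtual_network_expected_flows
    {V T : Type*} [Fintype V] [Fintype T] [DecidableEq V] [Nonempty V] [Nonempty T]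
    (r : T → Finset V) (hr : ∀ t, (r t).Nonempty)
    (x lam : T → ℝ) (hx : ∀ t, 0 < x t) (hlam : ∀ t, 0 ≤ lam t)
    (hf : ∀ v : V, (∑ t : T, if v ∈ r t then x t * lam t else 0) < 1)
    (t : T) :
    (∑' n : T → ℕ,
        (n t : ℝ) *
          (sfaPhiFun (fun v t' => if v ∈ r t' then (1 : ℝ) else 0) (fun _ => 1) n *
              (∏ t' : T, (x t' * lam t') ^ n t') /
            sfaPhi (fun v t' => if v ∈ r t' then (1 : ℝ) else 0) (fun _ => 1)
              (fun t' => x t' * lam t'))) =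
      ∑ v ∈ r t, x t * lam t / (1 - ∑ t' : T, if v ∈ r t' then x t' * lam t' else 0) := by
  have h := aux_main (fun v t' => if v ∈ r t' then (1 : ℝ) else 0)
    (fun l j h => by by_contra hc; simp_all)
    (fun l j h => by
      by_cases hc : l ∈ r j
      · simp [hc] at h
      · simp [hc])
    (fun t' => x t' * lam t') (fun t' => mul_nonneg (hx t').le (hlam t'))
    (fun v => by simpa [ite_mul] using hf v) t
  rw [h, ← Finset.sum_subtype (r t) (p := fun l => 0 < if l ∈ r t then (1 : ℝ) else 0)
    (fun v => by by_cases hv : v ∈ r t <;> simp [hv])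
    (fun l => x t * lam t / (1 - ∑ j, (if l ∈ r j then (1 : ℝ) else 0) * (x j * lam j)))]
  simp only [ite_mul, one_mul, zero_mul]
end
end
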